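/- arXiv:1210.6071 — 2 statements merged into one kernel-verified Lean document; each statement's English description precedes it below -/
import Mathlib

section
/- Let f : ℝⁿ → ℂ be a Schwartz function and let Δ be the Euclidean Laplacian. Then the hyperplane Radon transform intertwines Δ with the operator □ given by second differentiation in the distance parameter: (Δf)^(u,s) = ∂²/∂s² f̂(u,s) for all unit vectors u and s ∈ ℝ. -/
open MeasureTheory

/-- The hyperplane Radon transform `f̂(u,s) = ∫_{⟪x,u⟫=s} f dσ`. -/
noncomputable def radonTransform {n : ℕ} (f : EuclideanSpace ℝ (Fin n) → ℂ)
    (u : EuclideanSpace ℝ (Fin n)) (s : ℝ) : ℂ :=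
  ∫ v : ((ℝ ∙ u)ᗮ : Submodule ℝ (EuclideanSpace ℝ (Fin n))), f (s • u + (v : EuclideanSpace ℝ (Fin n)))

/-- The Euclidean Laplacian `Δ = ∑ ∂²/∂x_j²`. -/
noncomputable def laplacian {n : ℕ} (f : EuclideanSpace ℝ (Fin n) → ℂ)
    (x : EuclideanSpace ℝ (Fin n)) : ℂ :=
  ∑ i : Fin n, iteratedDeriv 2 (fun t : ℝ => f (x + t • EuclideanSpace.single i (1 : ℝ))) 0

open LineDeriv Laplacian in
/-- The pointwise Laplacian of a Schwartz function is the sum of its iterated line derivatives. -/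
theorem SchwartzMap.laplacian_eq_sum_lineDerivOp {n : ℕ} {ι : Type*} [Fintype ι]
    (b : OrthonormalBasis ι ℝ (EuclideanSpace ℝ (Fin n)))
    (f : SchwartzMap (EuclideanSpace ℝ (Fin n)) ℂ) (x : EuclideanSpace ℝ (Fin n)) :
    _root_.laplacian (fun y => f y) x = ∑ i, (∂_{b i} (∂_{b i} f)) x := by
  have hderiv (g : SchwartzMap (EuclideanSpace ℝ (Fin n)) ℂ) (m : EuclideanSpace ℝ (Fin n))
      (t : ℝ) : deriv (fun t : ℝ => g (x + t • m)) t = (∂_{m} g) (x + t • m) := by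
    rw [SchwartzMap.lineDerivOp_apply_eq_fderiv]
    have h : HasDerivAt (fun t : ℝ => x + t • m) m t := by
      simpa using ((hasDerivAt_id t).smul_const m).const_add x
    exact ((g.differentiableAt (x := x + t • m)).hasFDerivAt.comp_hasDerivAt t h).deriv
  have hsum : ∑ i, (∂_{b i} (∂_{b i} f)) x = (Δ f) x := by
    rw [SchwartzMap.laplacian_eq_sum b f, sum_apply]
  rw [hsum, SchwartzMap.laplacian_eq_sum (EuclideanSpace.basisFun (Fin n) ℝ) f,
    sum_apply, _root_.laplacian]
  refine Finset.sum_congr rfl fun i _ => ?_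
  rw [EuclideanSpace.basisFun_apply, iteratedDeriv_succ, iteratedDeriv_one,
    funext (hderiv f _), hderiv]
  simp

/-- A Schwartz function is integrable on every affine subspace. -/
theorem SchwartzMap.integrable_add_submodule {E F : Type*} [NormedAddCommGroup E]
    [InnerProductSpace ℝ E] [FiniteDimensional ℝ E] [MeasurableSpace E] [BorelSpace E]
    [NormedAddCommGroup F] [NormedSpace ℝ F] (f : SchwartzMap E F) (W : Submodule ℝ E) (a : E) :
    Integrable (fun v : W => f (a + (v : E))) := by
  have hg : (fun v : W => a + (v : E)).HasTemperateGrowth :=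
    (Function.HasTemperateGrowth.const a).add W.subtypeL.hasTemperateGrowth
  have h'g : AntilipschitzWith 1 (fun v : W => a + (v : E)) :=
    AntilipschitzWith.of_le_mul_dist fun v w => by simp [Subtype.dist_eq]
  exact (SchwartzMap.compCLMOfAntilipschitz ℝ hg h'g f).integrable

open LineDeriv in
/-- The integral over an affine subspace of a derivative in a tangential direction vanishes. -/
theorem SchwartzMap.integral_lineDerivOp_submodule_eq_zero {E F : Type*} [NormedAddCommGroup E]
    [InnerProductSpace ℝ E] [FiniteDimensional ℝ E] [MeasurableSpace E] [BorelSpace E]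
    [NormedAddCommGroup F] [NormedSpace ℝ F] (f : SchwartzMap E F) (W : Submodule ℝ E) (a : E)
    (w : W) :
    ∫ v : W, (∂_{(w : E)} f) (a + (v : E)) = 0 := by
  have h := integral_bilinear_hasLineDerivAt_right_eq_neg_left_of_integrable
    (μ := (volume : Measure W)) (f := fun _ : W => (1 : ℝ)) (f' := fun _ => 0)
    (g := fun v : W => f (a + (v : E))) (g' := fun v : W => (∂_{(w : E)} f) (a + (v : E)))
    (v := w) (B := ContinuousLinearMap.lsmul ℝ ℝ) (by simp)
    (by simpa using (∂_{(w : E)} f).integrable_add_submodule W a)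
    (by simpa using f.integrable_add_submodule W a)
    (fun x _ => hasDerivAt_const _ _) (fun v _ => ?_)
  · simpa using h
  · rw [SchwartzMap.lineDerivOp_apply_eq_fderiv]
    have h : HasFDerivAt (fun v : W => a + (v : E)) W.subtypeL v :=
      W.subtypeL.hasFDerivAt.const_add a
    exact ((f.differentiableAt (x := a + (v : E))).hasFDerivAt.comp v h).hasLineDerivAt w

open LineDeriv in
/-- The `s`-derivative of the Radon transform of a Schwartz function is the Radon transform of its
derivative in the normal direction. -/
theorem SchwartzMap.hasDerivAt_radonTransform {n : ℕ}
    (f : SchwartzMap (EuclideanSpace ℝ (Fin n)) ℂ) (u : EuclideanSpace ℝ (Fin n)) (s : ℝ) :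
    HasDerivAt (fun t : ℝ => radonTransform (fun x => f x) u t)
      (radonTransform (fun x => (∂_{u} f) x) u s) s := by
  let W : Submodule ℝ (EuclideanSpace ℝ (Fin n)) := (ℝ ∙ u)ᗮ
  let k := Module.finrank ℝ W + 1
  let g := ∂_{u} f
  obtain ⟨C, hC⟩ : ∃ C : ℝ, ∀ x, (1 + ‖x‖) ^ k * ‖g x‖ ≤ C := ⟨_, fun x => by
    simpa using SchwartzMap.one_add_le_sup_seminorm_apply (𝕜 := ℝ) (m := (k, 0)) le_rfl le_rfl g x⟩
  have hC0 : 0 ≤ C := le_trans (by positivity) (hC 0)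
  have hnorm (t : ℝ) (v : W) : ‖(v : EuclideanSpace ℝ (Fin n))‖ ≤ ‖t • u + v‖ := by
    have horth : inner ℝ (t • u) (v : EuclideanSpace ℝ (Fin n)) = 0 := by
      rw [inner_smul_left, Submodule.mem_orthogonal_singleton_iff_inner_right.mp v.2, mul_zero]
    have := norm_add_sq_eq_norm_sq_add_norm_sq_real horth
    nlinarith [norm_nonneg (t • u + (v : EuclideanSpace ℝ (Fin n))), norm_nonneg (t • u),
      norm_nonneg (v : EuclideanSpace ℝ (Fin n))]
  have hbound (t : ℝ) (v : W) :
      ‖g (t • u + v)‖ ≤ C * (1 + ‖v‖) ^ (-(k : ℝ)) := by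
    rw [Real.rpow_neg (by positivity), Real.rpow_natCast, ← div_eq_mul_inv,
      le_div_iff₀ (by positivity), mul_comm]
    refine le_trans ?_ (hC (t • u + v))
    gcongr
    exact hnorm t v
  refine (hasDerivAt_integral_of_dominated_loc_of_deriv_le (μ := (volume : Measure W))
    (F := fun t v => f (t • u + (v : EuclideanSpace ℝ (Fin n))))
    (F' := fun t v => g (t • u + (v : EuclideanSpace ℝ (Fin n))))
    (bound := fun v => C * (1 + ‖v‖) ^ (-(k : ℝ))) (s := Set.univ) Filter.univ_mem
    (.of_forall fun t => (f.integrable_add_submodule W (t • u)).aestronglyMeasurable)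
    (f.integrable_add_submodule W (s • u))
    (g.integrable_add_submodule W (s • u)).aestronglyMeasurable
    (.of_forall fun v t _ => hbound t v)
    ((integrable_one_add_norm (by simp [k])).const_mul C)
    (.of_forall fun v t _ => ?_)).2
  have h : HasDerivAt (fun t : ℝ => t • u + (v : EuclideanSpace ℝ (Fin n))) u t := by
    simpa using ((hasDerivAt_id t).smul_const u).add_const (v : EuclideanSpace ℝ (Fin n))
  simp only [g, SchwartzMap.lineDerivOp_apply_eq_fderiv]
  exact f.differentiableAt.hasFDerivAt.comp_hasDerivAt t h

/-- The hyperplane Radon transform intertwines the Euclidean Laplacian `Δ` with the operator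
`□ = ∂²/∂s²` of second differentiation in the distance parameter:
`(Δf)^(u,s) = ∂²/∂s² f̂(u,s)` for Schwartz `f`, every unit vector `u` and every `s ∈ ℝ`. -/
theorem radon_intertwines_laplacian {n : ℕ} (f : SchwartzMap (EuclideanSpace ℝ (Fin n)) ℂ)
    (u : EuclideanSpace ℝ (Fin n)) (hu : ‖u‖ = 1) (s : ℝ) :
    radonTransform (fun x => laplacian (fun y => f y) x) u s =
      iteratedDeriv 2 (fun t : ℝ => radonTransform (fun x => f x) u t) s := by
  have horth : Orthonormal ℝ (Subtype.val : ({u} : Set (EuclideanSpace ℝ (Fin n))) → _) := by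
    rw [orthonormal_subtype_iff_ite]
    simp [hu]
  obtain ⟨w, b, hw, hb⟩ := horth.exists_orthonormalBasis_extension
  let i₀ : w := ⟨u, hw rfl⟩
  have hi₀ : b i₀ = u := by rw [hb]
  rw [iteratedDeriv_succ, iteratedDeriv_one, funext fun t => (f.hasDerivAt_radonTransform u t).deriv,
    ((LineDeriv.lineDerivOp u f).hasDerivAt_radonTransform u s).deriv]
  simp only [f.laplacian_eq_sum_lineDerivOp b, radonTransform]
  rw [integral_finsetSum _ fun i _ => SchwartzMap.integrable_add_submodule _ _ _,
    Finset.sum_eq_single i₀, hi₀]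
  · intro i _ hi
    have hmem : b i ∈ (ℝ ∙ u)ᗮ := by
      rw [Submodule.mem_orthogonal_singleton_iff_inner_right, ← hi₀]
      exact b.orthonormal.2 hi.symm
    exact SchwartzMap.integral_lineDerivOp_submodule_eq_zero _ _ _ ⟨b i, hmem⟩
  · simp
end

section
/- (Helgason support theorem, compactly supported case) Let f : ℝⁿ → ℂ be continuous with compact support and let A > 0. If the hyperplane Radon transform f̂(ξ) = 0 for every affine hyperplane ξ with distance d(0,ξ) > A from the origin, then f(x) = 0 for all x with ‖x‖ > A. -/
open MeasureTheory

open scoped InnerProductSpace FourierTransform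

section InnerProductSpace

variable {E : Type*} [NormedAddCommGroup E] [InnerProductSpace ℝ E] [FiniteDimensional ℝ E]
  [MeasurableSpace E] [BorelSpace E]

/-- Fubini's theorem along the hyperplanes orthogonal to a unit vector. -/
theorem integral_eq_integral_integral_orthogonal_span_singleton {u : E} (hu : ‖u‖ = 1)
    {g : E → ℂ} (hg : Integrable g) :
    ∫ x, g x = ∫ s : ℝ, ∫ v : (ℝ ∙ u)ᗮ, g (s • u + (v : E)) := by
  let e : WithLp 2 ((ℝ ∙ u) × (ℝ ∙ u)ᗮ) ≃ₗᵢ[ℝ] E :=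
    (ℝ ∙ u).orthogonalDecomposition.symm
  let l : ℝ ≃ₗᵢ[ℝ] (ℝ ∙ u) := LinearIsometryEquiv.toSpanUnitSingleton u hu
  let ψ : ℝ × (ℝ ∙ u)ᗮ → E := fun p ↦ p.1 • u + (p.2 : E)
  have hψ : MeasurePreserving ψ := by
    have h := (e.measurePreserving.comp (WithLp.volume_preserving_toLp (ℝ ∙ u) (ℝ ∙ u)ᗮ)).comp
      (l.measurePreserving.prod (MeasurePreserving.id (volume : Measure (ℝ ∙ u)ᗮ)))
    convert! h using 1
  have hψi : Integrable (fun p ↦ g (ψ p)) := hψ.integrable_comp_of_integrable hg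
  have hae : AEStronglyMeasurable g (Measure.map ψ volume) := by
    rw [hψ.map_eq]; exact hg.aestronglyMeasurable
  rw [← hψ.map_eq, integral_map hψ.measurable.aemeasurable hae]
  exact integral_prod _ hψi

/-- Differentiating a ridge function under the integral sign. -/
theorem hasDerivAt_integral_ridge {g : E → ℂ} (hg : Continuous g) (hgs : HasCompactSupport g)
    {Φ φ : ℝ → ℝ} (hφ : Continuous φ) (hΦ : ∀ t, HasDerivAt Φ (φ t) t) (w v : E) :
    HasDerivAt (fun ε : ℝ ↦ ∫ x, Φ ⟪x, w + ε • v⟫_ℝ • g x)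
      (∫ x, φ ⟪x, w⟫_ℝ • ⟪x, v⟫_ℝ • g x) 0 := by
  have hΦc : Continuous Φ := continuous_iff_continuousAt.2 fun t ↦ (hΦ t).continuousAt
  have hint {h : E → ℝ} (hh : Continuous h) : Integrable fun x ↦ h x • g x :=
    (hh.smul hg).integrable_of_hasCompactSupport hgs.smul_left
  let F' : ℝ → E → ℂ := fun ε x ↦ (φ ⟪x, w + ε • v⟫_ℝ * ⟪x, v⟫_ℝ) • g x
  have hF'c : Continuous fun p : ℝ × E ↦ F' p.1 p.2 := by fun_prop
  obtain ⟨C, hC⟩ := ((isCompact_Icc (a := (-1 : ℝ)) (b := 1)).prod hgs).exists_bound_of_continuousOn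
    hF'c.continuousOn
  have key := hasDerivAt_integral_of_dominated_loc_of_deriv_le (μ := (volume : Measure E))
    (F := fun (ε : ℝ) x ↦ Φ ⟪x, w + ε • v⟫_ℝ • g x) (F' := F') (x₀ := 0)
    (bound := (tsupport g).indicator fun _ ↦ C) (Icc_mem_nhds neg_one_lt_zero one_pos)
    (.of_forall fun ε ↦ (hint (by fun_prop)).aestronglyMeasurable) (hint (by fun_prop))
    (hint (by fun_prop)).aestronglyMeasurable
    (.of_forall fun x ε hε ↦ ?_)
    ((integrable_indicator_iff hgs.measurableSet).2 (integrableOn_const hgs.measure_lt_top.ne))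
    (.of_forall fun x ε _ ↦ ?_)
  · simpa [F', mul_smul] using key.2
  · by_cases hx : x ∈ tsupport g
    · simpa [hx] using hC (ε, x) ⟨hε, hx⟩
    · simp [F', hx, image_eq_zero_of_notMem_tsupport hx]
  · refine HasDerivAt.smul_const (HasDerivAt.comp ε (hΦ _) ?_) (g x)
    simpa [inner_add_right, real_inner_smul_right] using
      ((hasDerivAt_id ε).mul_const ⟪x, v⟫_ℝ).const_add ⟪x, w⟫_ℝ

/-- If `g` is orthogonal to all ridge functions supported in half-spaces missing the ball of
radius `A`, then so is the product of `g` with any power of a linear form. -/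
theorem integral_ridge_smul_inner_pow_eq_zero {g : E → ℂ} (hg : Continuous g)
    (hgs : HasCompactSupport g) {A : ℝ}
    (h : ∀ (w : E) (c : ℝ) (φ : ℝ → ℝ), A * ‖w‖ < c → Continuous φ → (∀ t ≤ c, φ t = 0) →
      ∫ x, φ ⟪x, w⟫_ℝ • g x = 0) (v : E) (k : ℕ) :
    ∀ (w : E) (c : ℝ) (φ : ℝ → ℝ), A * ‖w‖ < c → Continuous φ → (∀ t ≤ c, φ t = 0) →
      ∫ x, φ ⟪x, w⟫_ℝ • ⟪x, v⟫_ℝ ^ k • g x = 0 := by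
  induction k with
  | zero => simpa using h
  | succ k ih =>
    intro w c φ hc hφ hφ0
    let Φ : ℝ → ℝ := fun t ↦ ∫ s in c..t, φ s
    have hΦ0 : ∀ t ≤ c, Φ t = 0 := fun t ht ↦
      intervalIntegral.integral_zero_ae <| .of_forall fun s hs ↦ hφ0 s <| by
        rw [Set.uIoc_of_ge ht] at hs; exact hs.2
    have hks : HasCompactSupport fun x ↦ ⟪x, v⟫_ℝ ^ k • g x :=
      hgs.smul_left (f := fun x ↦ ⟪x, v⟫_ℝ ^ k)
    have hd := hasDerivAt_integral_ridge (by fun_prop) hks hφ (fun t ↦ hφ.integral_hasStrictDerivAt c t |>.hasDerivAt) w v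
    have hΦc : Continuous Φ := continuous_iff_continuousAt.2 fun t ↦
      (hφ.integral_hasStrictDerivAt c t).hasDerivAt.continuousAt
    have hev : ∀ᶠ ε : ℝ in nhds 0, A * ‖w + ε • v‖ < c :=
      (Continuous.continuousAt (by fun_prop)).eventually_lt continuousAt_const (by simpa using hc)
    have hz : (fun ε : ℝ ↦ ∫ x, Φ ⟪x, w + ε • v⟫_ℝ • ⟪x, v⟫_ℝ ^ k • g x) =ᶠ[nhds 0] fun _ ↦ 0 :=
      hev.mono fun ε hε ↦ ih _ c Φ hε hΦc hΦ0
    have := hd.unique ((hasDerivAt_const (0 : ℝ) (0 : ℂ)).congr_of_eventuallyEq hz)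
    simpa only [smul_smul, pow_succ'] using this

/-- A continuous compactly supported function with vanishing moments is zero. -/
theorem eq_zero_of_forall_integral_inner_pow_smul_eq_zero {g : E → ℂ} (hg : Continuous g)
    (hgs : HasCompactSupport g) (h : ∀ (v : E) (k : ℕ), ∫ x, ⟪x, v⟫_ℝ ^ k • g x = 0) : g = 0 := by
  have hF : 𝓕 g = 0 := by
    ext v
    rw [Real.fourier_eq']
    let a : E → ℝ := fun x ↦ -2 * Real.pi * ⟪x, v⟫_ℝ
    have ha : Continuous a := by fun_prop
    have hsum := hasSum_integral_of_dominated_convergence (μ := (volume : Measure E))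
      (F := fun (k : ℕ) x ↦ ((a x * Complex.I) ^ k / k.factorial : ℂ) • g x)
      (f := fun x ↦ Complex.exp (a x * Complex.I) • g x)
      (fun k x ↦ |a x| ^ k / k.factorial * ‖g x‖)
      (fun k ↦ Continuous.aestronglyMeasurable (by fun_prop))
      (fun k ↦ .of_forall fun x ↦ by simp)
      (.of_forall fun x ↦ (Real.summable_pow_div_factorial _).mul_right _)
      ?_ (.of_forall fun x ↦ by
        simpa only [Complex.exp_eq_exp_ℂ] using
          (NormedSpace.expSeries_div_hasSum_exp (a x * Complex.I : ℂ)).smul_const (g x))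
    · have hz (k : ℕ) : ∫ x, ((a x * Complex.I) ^ k / k.factorial : ℂ) • g x = 0 := by
        have : ∀ x, ((a x * Complex.I) ^ k / k.factorial : ℂ) • g x =
            ((-2 * Real.pi * Complex.I) ^ k / k.factorial : ℂ) • (⟪x, v⟫_ℝ ^ k • g x) := fun x ↦ by
          simp only [a, smul_eq_mul, Complex.real_smul]; push_cast; ring
        simp_rw [this, integral_smul, h v k, smul_zero]
      simp only [hz] at hsum
      exact hsum.unique hasSum_zero
    · have he : (fun x ↦ ∑' k : ℕ, |a x| ^ k / k.factorial * ‖g x‖) =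
          fun x ↦ Real.exp |a x| * ‖g x‖ := by
        ext x
        rw [tsum_mul_right, Real.exp_eq_exp_ℝ, NormedSpace.exp_eq_tsum_div]
      rw [he]
      exact Continuous.integrable_of_hasCompactSupport (by fun_prop) hgs.norm.mul_left
  have hinv := hg.fourierInv_fourier_eq (hg.integrable_of_hasCompactSupport hgs)
    (by rw [hF]; exact integrable_zero _ _ _)
  rw [← hinv, hF]
  ext x
  simp [Real.fourierInv_eq]

end InnerProductSpace

/-- A function whose Radon transform vanishes on all hyperplanes missing a ball is orthogonal to
all ridge functions supported in a half-space missing that ball. -/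
theorem integral_ridge_smul_eq_zero {n : ℕ} {f : EuclideanSpace ℝ (Fin n) → ℂ}
    (hcont : Continuous f) (hsupp : HasCompactSupport f) {A : ℝ}
    (hvanish : ∀ (u : EuclideanSpace ℝ (Fin n)) (s : ℝ), ‖u‖ = 1 → A < |s| →
      radonTransform f u s = 0) (w : EuclideanSpace ℝ (Fin n)) (c : ℝ) (φ : ℝ → ℝ)
    (hc : A * ‖w‖ < c) (hφ : Continuous φ) (hφ0 : ∀ t ≤ c, φ t = 0) :
    ∫ x, φ ⟪x, w⟫_ℝ • f x = 0 := by
  rcases eq_or_ne w 0 with rfl | hw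
  · simp [hφ0 0 (by simpa using hc.le)]
  have hw' : 0 < ‖w‖ := norm_pos_iff.2 hw
  obtain ⟨u, hu, hwu⟩ : ∃ u : EuclideanSpace ℝ (Fin n), ‖u‖ = 1 ∧ w = ‖w‖ • u :=
    ⟨‖w‖⁻¹ • w, norm_smul_inv_norm (𝕜 := ℝ) hw, by simp [smul_smul, hw'.ne']⟩
  have hs : HasCompactSupport fun x ↦ φ ⟪x, w⟫_ℝ • f x :=
    hsupp.smul_left (f := fun x ↦ φ ⟪x, w⟫_ℝ)
  rw [integral_eq_integral_integral_orthogonal_span_singleton hu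
    (Continuous.integrable_of_hasCompactSupport (by fun_prop) hs)]
  refine integral_eq_zero_of_ae (.of_forall fun s ↦ ?_)
  have hin (v : (ℝ ∙ u)ᗮ) : ⟪s • u + (v : EuclideanSpace ℝ (Fin n)), w⟫_ℝ = s * ‖w‖ := by
    have huv : ⟪(v : EuclideanSpace ℝ (Fin n)), u⟫_ℝ = 0 :=
      Submodule.mem_orthogonal_singleton_iff_inner_left.1 v.2
    rw [hwu, inner_add_left, real_inner_smul_left, real_inner_smul_right, real_inner_smul_right,
      huv, real_inner_self_eq_norm_sq, hu, ← hwu]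
    ring
  simp only [hin, integral_smul, Pi.zero_apply]
  rcases le_or_gt s A with hs | hs
  · rw [hφ0 _ ((mul_le_mul_of_nonneg_right hs hw'.le).trans hc.le), zero_smul]
  · have := hvanish u s hu (hs.trans_le (le_abs_self s))
    rw [radonTransform] at this
    rw [this, smul_zero]

/-- **Helgason support theorem** (compactly supported case): if `f` is continuous with
compact support on `ℝⁿ` and its hyperplane Radon transform vanishes on every hyperplane at
distance `> A` from the origin, then `f` vanishes outside the closed ball of radius `A`. -/
theorem radon_support_theorem {n : ℕ} (f : EuclideanSpace ℝ (Fin n) → ℂ)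
    (hcont : Continuous f) (hsupp : HasCompactSupport f) (A : ℝ) (hA : 0 < A)
    (hvanish : ∀ (u : EuclideanSpace ℝ (Fin n)) (s : ℝ), ‖u‖ = 1 → A < |s| →
      radonTransform f u s = 0) :
    ∀ x : EuclideanSpace ℝ (Fin n), A < ‖x‖ → f x = 0 := by
  intro w hw
  obtain ⟨c, hc, hcw⟩ := exists_between (mul_lt_mul_of_pos_right hw (hA.trans hw))
  let φ : ℝ → ℝ := fun t ↦ max (t - c) 0
  have hφ : Continuous φ := by fun_prop
  have hs : HasCompactSupport fun x ↦ φ ⟪x, w⟫_ℝ • f x :=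
    hsupp.smul_left (f := fun x ↦ φ ⟪x, w⟫_ℝ)
  have hzero : (fun x ↦ φ ⟪x, w⟫_ℝ • f x) = 0 := by
    refine eq_zero_of_forall_integral_inner_pow_smul_eq_zero (by fun_prop) hs
      fun v k ↦ ?_
    simp_rw [smul_comm (⟪_, v⟫_ℝ ^ k)]
    exact integral_ridge_smul_inner_pow_eq_zero hcont hsupp
      (integral_ridge_smul_eq_zero hcont hsupp hvanish) v k w c φ hc hφ
      fun t ht ↦ max_eq_right (sub_nonpos.2 ht)
  have hφw : φ ⟪w, w⟫_ℝ ≠ 0 := by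
    rw [real_inner_self_eq_norm_mul_norm]
    exact (lt_max_of_lt_left (sub_pos.2 hcw)).ne'
  exact (smul_eq_zero.1 (congrFun hzero w)).resolve_left hφw
end
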